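/- Let P(x) = Σ_{|β| ≤ d} a_β x^β be a real polynomial of degree d ≥ 1 on ℝ^n and let α be a multi-index with |α| = d and a_α ≠ 0. Then there exists a constant C'_{d,n} > 0 depending only on d and n such that for all δ > 0 and all r > 0, vol_n(V_δ ∩ Δ_r^n) ≤ (C'_{d,n} / (α!·|a_α|)^{1/d}) · r^{n−1} · δ^{1/d}, where α! := α_1!⋯α_n!. -/

import Mathlib

open MeasureTheory Metric MvPolynomial
open scoped ENNReal NNReal

/-- The open cube `Δ_r^n = (-r, r)^n` in `ℝ^n`. -/
def cube (n : ℕ) (r : ℝ) : Set (EuclideanSpace ℝ (Fin n)) :=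
  {x | ∀ i, x i ∈ Set.Ioo (-r) r}

/-- The sublevel set `V_δ = {x ∈ ℝ^n : |P(x)| ≤ δ}`. -/
def sublevel {n : ℕ} (P : MvPolynomial (Fin n) ℝ) (δ : ℝ) :
    Set (EuclideanSpace ℝ (Fin n)) :=
  {x | |eval (fun i => x i) P| ≤ δ}

/-- One-dimensional sublevel estimate. -/
lemma sub_one_dim (d : ℕ) (hd : 1 ≤ d) (p : Polynomial ℝ) (hp : p.natDegree ≤ d)
    (ha : p.coeff d ≠ 0) (δ : ℝ) (hδ : 0 < δ) :
    volume {t : ℝ | |p.eval t| ≤ δ} ≤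
      ENNReal.ofReal (d * (2 * (δ / |p.coeff d|) ^ ((1 : ℝ) / d))) := by
  have hdeg : p.natDegree = d := le_antisymm hp (Polynomial.le_natDegree_of_ne_zero ha)
  set s : ℝ := (δ / |p.coeff d|) ^ ((1 : ℝ) / d) with hs
  have hapos : 0 < |p.coeff d| := abs_pos.mpr ha
  have hs0 : 0 ≤ s := by positivity
  have hsd : |p.coeff d| * s ^ d = δ := by
    rw [hs, one_div, Real.rpow_inv_natCast_pow (by positivity) (by omega)]
    field_simp
  set q : Polynomial ℂ := p.map (algebraMap ℝ ℂ) with hq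
  have hqs : q.Splits := IsAlgClosed.splits q
  have hqd : q.natDegree = d := by rw [hq, Polynomial.natDegree_map]; exact hdeg
  have hcard : q.roots.card = d := by rw [← hqs.natDegree_eq_card_roots, hqd]
  have hlead : ‖q.leadingCoeff‖ = |p.coeff d| := by
    rw [Polynomial.leadingCoeff, hqd, hq, Polynomial.coeff_map]
    simp
  have hsub : {t : ℝ | |p.eval t| ≤ δ} ⊆
      ⋃ z ∈ q.roots.toFinset, Set.Icc (z.re - s) (z.re + s) := by
    intro t ht
    by_contra hcon
    simp only [Set.mem_iUnion, Multiset.mem_toFinset, Set.mem_Icc, not_exists] at hcon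
    have hfar : ∀ z ∈ q.roots, s < ‖(t : ℂ) - z‖ := by
      intro z hz
      have h1 := hcon z hz
      have h2 : |t - z.re| ≤ ‖(t : ℂ) - z‖ := by
        simpa using Complex.abs_re_le_norm ((t : ℂ) - z)
      refine lt_of_lt_of_le ?_ h2
      by_contra h3
      rw [not_lt, abs_le] at h3
      exact h1 ⟨by linarith, by linarith⟩
    have hev : |p.eval t| = |p.coeff d| * (q.roots.map (fun z => ‖(t : ℂ) - z‖)).prod := by
      have h1 : q.eval (t : ℂ) = ((p.eval t : ℝ) : ℂ) := by
        rw [hq]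
        exact Polynomial.eval_map_apply (algebraMap ℝ ℂ) t
      have h2 := hqs.eval_eq_prod_roots (t : ℂ)
      rw [h1] at h2
      have h3 := congrArg norm h2
      rw [norm_mul, hlead, Complex.norm_real, Real.norm_eq_abs] at h3
      rw [h3]
      congr 1
      have := map_multiset_prod (normHom : ℂ →*₀ ℝ) (q.roots.map (fun z => (t : ℂ) - z))
      rw [Multiset.map_map] at this
      exact this
    have hprod : ∀ m : Multiset ℂ, m ≠ 0 → (∀ z ∈ m, s < ‖(t : ℂ) - z‖) →
        s ^ m.card < (m.map (fun z => ‖(t : ℂ) - z‖)).prod := by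
      intro m
      induction m using Multiset.induction_on with
      | empty => intro h; exact absurd rfl h
      | cons a m ih =>
        intro _ h
        have ha := h a (Multiset.mem_cons_self a m)
        rw [Multiset.card_cons, Multiset.map_cons, Multiset.prod_cons, pow_succ']
        by_cases hm : m = 0
        · subst hm; simpa using ha
        · have := ih hm (fun z hz => h z (Multiset.mem_cons_of_mem hz))
          exact mul_lt_mul'' ha this hs0 (by positivity)
    have h4 := hprod q.roots (by intro h; rw [h] at hcard; simp at hcard; omega) hfar
    rw [hcard] at h4
    have h5 : |p.eval t| ≤ δ := ht
    rw [hev, ← hsd] at h5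
    exact absurd (mul_lt_mul_of_pos_left h4 hapos) (not_lt.mpr h5)
  calc volume {t : ℝ | |p.eval t| ≤ δ}
      ≤ volume (⋃ z ∈ q.roots.toFinset, Set.Icc (z.re - s) (z.re + s)) := measure_mono hsub
    _ ≤ ∑ z ∈ q.roots.toFinset, volume (Set.Icc (z.re - s) (z.re + s)) :=
        measure_biUnion_finset_le _ _
    _ = ∑ z ∈ q.roots.toFinset, ENNReal.ofReal (2 * s) := by
        refine Finset.sum_congr rfl fun z _ => ?_
        rw [Real.volume_Icc]; congr 1; ring
    _ = (q.roots.toFinset.card : ℝ≥0∞) * ENNReal.ofReal (2 * s) := by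
        rw [Finset.sum_const, nsmul_eq_mul]
    _ ≤ (d : ℝ≥0∞) * ENNReal.ofReal (2 * s) := by
        gcongr
        rw [← hcard]; exact_mod_cast Multiset.toFinset_card_le _
    _ = ENNReal.ofReal (d * (2 * s)) := by
        rw [ENNReal.ofReal_mul (Nat.cast_nonneg d), ENNReal.ofReal_natCast]

/-- Top homogeneous part, as a function. -/
noncomputable def topFun {n : ℕ} (P : MvPolynomial (Fin n) ℝ) (d : ℕ) (w : Fin n → ℝ) : ℝ :=
  ∑ β ∈ P.support.filter (fun β => ∑ i, β i = d), coeff β P * ∏ i, w i ^ β i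

/-- Restriction of `P` to a line. -/
noncomputable def linePoly {n : ℕ} (P : MvPolynomial (Fin n) ℝ) (y w : Fin n → ℝ) :
    Polynomial ℝ :=
  ∑ β ∈ P.support, Polynomial.C (coeff β P) *
    ∏ i, (Polynomial.C (y i) + Polynomial.C (w i) * Polynomial.X) ^ β i

lemma linePoly_eval {n : ℕ} (P : MvPolynomial (Fin n) ℝ) (y w : Fin n → ℝ) (t : ℝ) :
    (linePoly P y w).eval t = eval (fun i => y i + w i * t) P := by
  rw [linePoly, MvPolynomial.eval_eq', Polynomial.eval_finsetSum]
  simp [Polynomial.eval_prod]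

lemma line_monomial {ι : Type*} (s : Finset ι) (β : ι → ℕ) (y w : ι → ℝ) :
    (∏ i ∈ s, (Polynomial.C (y i) + Polynomial.C (w i) * Polynomial.X) ^ β i).natDegree
      ≤ ∑ i ∈ s, β i ∧
    (∏ i ∈ s, (Polynomial.C (y i) + Polynomial.C (w i) * Polynomial.X) ^ β i).coeff
      (∑ i ∈ s, β i) = ∏ i ∈ s, w i ^ β i := by
  classical
  induction s using Finset.induction_on with
  | empty => simp
  | insert a s ha ih =>
    rw [Finset.prod_insert ha, Finset.sum_insert ha, Finset.prod_insert ha]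
    have h1 : (Polynomial.C (y a) + Polynomial.C (w a) * Polynomial.X).natDegree ≤ 1 := by
      compute_degree
    have h2 : ((Polynomial.C (y a) + Polynomial.C (w a) * Polynomial.X) ^ β a).natDegree ≤ β a := by
      refine Polynomial.natDegree_pow_le.trans ?_
      nlinarith
    refine ⟨Polynomial.natDegree_mul_le.trans (add_le_add h2 ih.1), ?_⟩
    rw [Polynomial.coeff_mul_add_eq_of_natDegree_le h2 ih.1, ih.2]
    have h3 := Polynomial.coeff_pow_of_natDegree_le (m := β a) h1
    rw [mul_one] at h3
    rw [h3]
    simp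

lemma support_le {n : ℕ} (P : MvPolynomial (Fin n) ℝ) (β : Fin n →₀ ℕ) (hβ : β ∈ P.support) :
    ∑ i, β i ≤ P.totalDegree := by
  have := MvPolynomial.le_totalDegree hβ
  rwa [Finsupp.sum_fintype _ _ (fun _ => rfl)] at this

lemma linePoly_deg {n d : ℕ} (P : MvPolynomial (Fin n) ℝ) (hP : P.totalDegree = d)
    (y w : Fin n → ℝ) :
    (linePoly P y w).natDegree ≤ d ∧ (linePoly P y w).coeff d = topFun P d w := by
  constructor
  · refine Polynomial.natDegree_sum_le_of_forall_le _ _ fun β hβ => ?_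
    refine Polynomial.natDegree_C_mul_le _ _ |>.trans ?_
    exact (line_monomial Finset.univ β y w).1.trans (hP ▸ support_le P β hβ)
  · rw [linePoly, Polynomial.finsetSum_coeff, topFun, Finset.sum_filter]
    refine Finset.sum_congr rfl fun β hβ => ?_
    rw [Polynomial.coeff_C_mul]
    have h := line_monomial Finset.univ β y w
    split_ifs with hc
    · rw [← hc, h.2]
    · rw [Polynomial.coeff_eq_zero_of_natDegree_lt, mul_zero]
      have := hP ▸ support_le P β hβ
      exact lt_of_le_of_lt h.1 (lt_of_le_of_ne this hc)

lemma one_dim_diff (a b : ℕ) (h : b ≤ a) :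
    ∑ k ∈ Finset.range (a + 1), ((-1 : ℝ) ^ (a - k) * a.choose k) * (k : ℝ) ^ b =
      if b = a then (a.factorial : ℝ) else 0 := by
  have h1 := fwdDiff_iter_eq_sum_shift (1 : ℝ) (fun r : ℝ => r ^ b) a 0
  have h2 : ∑ k ∈ Finset.range (a + 1), ((-1 : ℝ) ^ (a - k) * a.choose k) * (k : ℝ) ^ b =
      (fwdDiff (1 : ℝ))^[a] (fun r : ℝ => r ^ b) 0 := by
    rw [h1]
    refine Finset.sum_congr rfl fun k _ => ?_
    simp
  rw [h2]
  split_ifs with hab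
  · subst hab
    rw [fwdDiff_iter_eq_factorial]; simp
  · rw [fwdDiff_iter_pow_eq_zero_of_lt (lt_of_le_of_ne h hab)]; simp

lemma diff_top {n d : ℕ} (P : MvPolynomial (Fin n) ℝ) 
    (α : Fin n →₀ ℕ) (hα : (∑ i, α i) = d) (hc : coeff α P ≠ 0) :
    ∑ k ∈ Fintype.piFinset (fun i => Finset.range (α i + 1)),
      (∏ i, ((-1 : ℝ) ^ (α i - k i) * (α i).choose (k i))) * topFun P d (fun i => (k i : ℝ)) =
    ((∏ i, Nat.factorial (α i) : ℕ) : ℝ) * coeff α P := by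
  have key : ∀ β : Fin n →₀ ℕ, ∑ i, β i = d →
      ∑ k ∈ Fintype.piFinset (fun i => Finset.range (α i + 1)),
        (∏ i, ((-1 : ℝ) ^ (α i - k i) * (α i).choose (k i))) * ∏ i, (k i : ℝ) ^ β i =
      if β = α then ((∏ i, Nat.factorial (α i) : ℕ) : ℝ) else 0 := by
    intro β hβ
    simp_rw [← Finset.prod_mul_distrib]
    rw [← Finset.prod_univ_sum (fun i => Finset.range (α i + 1))
      (fun i k => ((-1 : ℝ) ^ (α i - k) * (α i).choose k) * (k : ℝ) ^ β i)]
    split_ifs with h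
    · subst h
      push_cast
      refine Finset.prod_congr rfl fun i _ => ?_
      rw [one_dim_diff _ _ le_rfl, if_pos rfl]
    · have : ∃ i, β i < α i := by
        by_contra hcon
        push Not at hcon
        apply h
        have := (Finset.sum_eq_sum_iff_of_le (fun i (_ : i ∈ Finset.univ) => hcon i)).mp
          (hα.trans hβ.symm)
        ext i
        exact (this i (Finset.mem_univ i)).symm
      obtain ⟨i, hi⟩ := this
      refine Finset.prod_eq_zero (Finset.mem_univ i) ?_
      rw [one_dim_diff _ _ hi.le, if_neg hi.ne]
  simp_rw [topFun, Finset.mul_sum]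
  rw [Finset.sum_comm]
  have : ∀ β ∈ P.support.filter (fun β => ∑ i, β i = d),
      ∑ k ∈ Fintype.piFinset (fun i => Finset.range (α i + 1)),
        (∏ i, ((-1 : ℝ) ^ (α i - k i) * (α i).choose (k i))) *
          (coeff β P * ∏ i, (k i : ℝ) ^ β i) =
      if β = α then ((∏ i, Nat.factorial (α i) : ℕ) : ℝ) * coeff β P else 0 := by
    intro β hβ
    have h := key β (Finset.mem_filter.mp hβ).2
    have : ∀ k : Fin n → ℕ, (∏ i, ((-1 : ℝ) ^ (α i - k i) * (α i).choose (k i))) *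
          (coeff β P * ∏ i, (k i : ℝ) ^ β i) = coeff β P *
          ((∏ i, ((-1 : ℝ) ^ (α i - k i) * (α i).choose (k i))) * ∏ i, (k i : ℝ) ^ β i) :=
      fun k => by ring
    simp_rw [this]
    rw [← Finset.mul_sum, h]
    split_ifs <;> ring
  rw [Finset.sum_congr rfl this, Finset.sum_ite_eq', if_pos]
  rw [Finset.mem_filter, MvPolynomial.mem_support_iff]
  exact ⟨hc, hα⟩

lemma topFun_smul {n d : ℕ} (P : MvPolynomial (Fin n) ℝ) (c : ℝ) (w : Fin n → ℝ) :
    topFun P d (fun i => c * w i) = c ^ d * topFun P d w := by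
  rw [topFun, topFun, Finset.mul_sum]
  refine Finset.sum_congr rfl fun β hβ => ?_
  have h := (Finset.mem_filter.mp hβ).2
  simp_rw [mul_pow]
  rw [Finset.prod_mul_distrib, Finset.prod_pow_eq_pow_sum, h]
  ring

lemma exists_dir {n d : ℕ} (hd : 1 ≤ d) (P : MvPolynomial (Fin n) ℝ) 
    (α : Fin n →₀ ℕ) (hα : (∑ i, α i) = d) (hc : coeff α P ≠ 0) :
    ∃ (w : Fin n → ℝ) (i : Fin n), w i = 1 ∧ (∀ j, |w j| ≤ 1) ∧
      ((∏ i, Nat.factorial (α i) : ℕ) : ℝ) * |coeff α P| ≤ (2 * d) ^ d * |topFun P d w| := by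
  have hsum := diff_top P α hα hc
  set A : ℝ := ((∏ i, Nat.factorial (α i) : ℕ) : ℝ) * |coeff α P| with hA
  have hfac : (0 : ℝ) < ((∏ i, Nat.factorial (α i) : ℕ) : ℝ) := by
    exact_mod_cast Finset.prod_pos fun i _ => Nat.factorial_pos _
  have hApos : 0 < A := mul_pos hfac (abs_pos.mpr hc)
  have hbin : ∑ k ∈ Fintype.piFinset (fun i => Finset.range (α i + 1)),
      (∏ i, ((α i).choose (k i) : ℝ)) = 2 ^ d := by
    rw [← Finset.prod_univ_sum (fun i => Finset.range (α i + 1))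
      (fun i k => ((α i).choose k : ℝ))]
    rw [← hα, ← Finset.prod_pow_eq_pow_sum]
    refine Finset.prod_congr rfl fun i _ => ?_
    exact_mod_cast Nat.sum_range_choose (α i)
  have hk : ∃ k ∈ Fintype.piFinset (fun i => Finset.range (α i + 1)),
      A ≤ 2 ^ d * |topFun P d (fun i => (k i : ℝ))| := by
    by_contra hcon
    push Not at hcon
    have h1 : A ≤ ∑ k ∈ Fintype.piFinset (fun i => Finset.range (α i + 1)),
        (∏ i, ((α i).choose (k i) : ℝ)) * |topFun P d (fun i => (k i : ℝ))| := by
      have : A = |((∏ i, Nat.factorial (α i) : ℕ) : ℝ) * coeff α P| := by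
        rw [abs_mul, abs_of_pos hfac]
      rw [this, ← hsum]
      refine (Finset.abs_sum_le_sum_abs _ _).trans (Finset.sum_le_sum fun k _ => ?_)
      rw [abs_mul, Finset.abs_prod]
      simp [abs_mul]
    have h2 : ∑ k ∈ Fintype.piFinset (fun i => Finset.range (α i + 1)),
        (∏ i, ((α i).choose (k i) : ℝ)) * |topFun P d (fun i => (k i : ℝ))| <
        ∑ k ∈ Fintype.piFinset (fun i => Finset.range (α i + 1)),
        (∏ i, ((α i).choose (k i) : ℝ)) * (A / 2 ^ d) := by
      refine Finset.sum_lt_sum_of_nonempty ⟨fun i => 0, by simp⟩ fun k hk => ?_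
      have h3 := hcon k hk
      rw [Fintype.mem_piFinset] at hk
      refine mul_lt_mul_of_pos_left ?_ ?_
      · rw [lt_div_iff₀ (by positivity)]; linarith
      · refine Finset.prod_pos fun i _ => ?_
        have := Finset.mem_range.mp (hk i)
        exact_mod_cast Nat.choose_pos (by omega)
    rw [← Finset.sum_mul, hbin] at h2
    have : (2 : ℝ) ^ d * (A / 2 ^ d) = A := by field_simp
    linarith
  obtain ⟨k, hkm, hk⟩ := hk
  have hne : Nonempty (Fin n) := by
    by_contra h
    rw [not_nonempty_iff] at h
    rw [Finset.univ_eq_empty, Finset.sum_empty] at hα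
    omega
  obtain ⟨i, hi⟩ := Finite.exists_max k
  have hkd : ∀ j, k j ≤ d := by
    intro j
    have h1 := Finset.mem_range.mp (Fintype.mem_piFinset.mp hkm j)
    have h2 : α j ≤ ∑ i, α i := Finset.single_le_sum (fun _ _ => Nat.zero_le _) (Finset.mem_univ j)
    omega
  have hscale : (fun j => (k j : ℝ)) = fun j => (k i : ℝ) * ((k j : ℝ) / k i) := by
    funext j
    by_cases h : k i = 0
    · have := hi j
      have : k j = 0 := by omega
      simp [h, this]
    · field_simp
  rw [hscale, topFun_smul] at hk
  have hki : k i ≠ 0 := by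
    intro h
    rw [h] at hk
    rw [Nat.cast_zero, zero_pow (by omega)] at hk
    simp at hk
    linarith
  have hkipos : (0 : ℝ) < k i := by positivity
  refine ⟨fun j => (k j : ℝ) / k i, i, div_self hkipos.ne', ?_, ?_⟩
  · intro j
    rw [abs_of_nonneg (by positivity), div_le_one hkipos]
    exact_mod_cast hi j
  · refine hk.trans ?_
    rw [abs_mul, abs_of_pos (by positivity), mul_pow, mul_assoc]
    gcongr
    exact_mod_cast hkd i

lemma slice_bound {m d : ℕ} (hd : 1 ≤ d) (P : MvPolynomial (Fin (m + 1)) ℝ)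
    (hP : P.totalDegree = d) (w : Fin (m + 1) → ℝ) (i : Fin (m + 1)) (hwi : w i = 1)
    (hw : ∀ j, |w j| ≤ 1) (hT : topFun P d w ≠ 0) (δ r : ℝ) (hδ : 0 < δ) (hr : 0 < r) :
    volume (sublevel P δ ∩ cube (m + 1) r) ≤
      ENNReal.ofReal (d * (2 * (δ / |topFun P d w|) ^ ((1 : ℝ) / d))) *
        ENNReal.ofReal ((4 * r) ^ m) := by
  set S : Set (Fin (m + 1) → ℝ) := {x | |eval x P| ≤ δ} ∩ {x | ∀ j, x j ∈ Set.Ioo (-r) r} with hS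
  have hSm : MeasurableSet S := by
    refine MeasurableSet.inter ?_ ?_
    · exact (isClosed_le (continuous_abs.comp (MvPolynomial.continuous_eval P))
        continuous_const).measurableSet
    · have : {x : Fin (m + 1) → ℝ | ∀ j, x j ∈ Set.Ioo (-r) r} =
          Set.pi Set.univ (fun _ => Set.Ioo (-r) r) := by ext x; simp
      rw [this]
      exact MeasurableSet.univ_pi fun _ => measurableSet_Ioo
  have e0 : volume (sublevel P δ ∩ cube (m + 1) r) = volume S :=
    (PiLp.volume_preserving_ofLp (Fin (m + 1))).measure_preimage hSm.nullMeasurableSet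
  have mp1 := (volume_preserving_piFinSuccAbove (fun _ : Fin (m + 1) => ℝ) i).symm
  have e1 := mp1.measure_preimage hSm.nullMeasurableSet
  set S1 := (MeasurableEquiv.piFinSuccAbove (fun _ : Fin (m + 1) => ℝ) i).symm ⁻¹' S with hS1
  have hS1m : MeasurableSet S1 := mp1.measurable hSm
  have mp2 : MeasurePreserving (fun p : ℝ × (Fin m → ℝ) =>
      (id p.1, p.2 + fun j => w (i.succAbove j) * p.1)) (volume.prod volume)
      (volume.prod volume) := by
    refine (MeasurePreserving.id (volume : Measure ℝ)).skew_product
      (g := fun t (z : Fin m → ℝ) => z + fun j => w (i.succAbove j) * t) ?_ ?_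
    · refine Continuous.measurable ?_
      unfold Function.uncurry
      fun_prop
    · exact Filter.Eventually.of_forall fun t => map_add_right_eq_self _ _
  have e2 := mp2.measure_preimage hS1m.nullMeasurableSet
  rw [e0, ← e1, Measure.volume_eq_prod, ← e2,
    Measure.prod_apply_symm (mp2.measurable hS1m)]
  set L := ENNReal.ofReal (d * (2 * (δ / |topFun P d w|) ^ ((1 : ℝ) / d))) with hL
  set B : Set (Fin m → ℝ) := Set.pi Set.univ (fun _ => Set.Ioo (-(2 * r)) (2 * r)) with hB
  have hBm : MeasurableSet B := MeasurableSet.univ_pi fun _ => measurableSet_Ioo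
  have hBv : volume B = ENNReal.ofReal ((4 * r) ^ m) := by
    rw [hB, Real.volume_pi_Ioo]
    simp only [Finset.prod_const, Finset.card_univ, Fintype.card_fin]
    rw [ENNReal.ofReal_pow (by positivity)]
    congr 2
    ring
  rw [← hBv, ← lintegral_indicator_const hBm]
  refine lintegral_mono fun z => ?_
  -- the section at z
  set y : Fin (m + 1) → ℝ := i.insertNth (α := fun _ => ℝ) 0 z with hy
  have hsec : ∀ t : ℝ, (MeasurableEquiv.piFinSuccAbove (fun _ : Fin (m + 1) => ℝ) i).symm
      (t, z + fun j => w (i.succAbove j) * t) = fun j => y j + w j * t := by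
    intro t
    change i.insertNth (α := fun _ => ℝ) t (z + fun j => w (i.succAbove j) * t) = _
    funext j
    refine Fin.succAboveCases i ?_ (fun j => ?_) j
    · simp [hy, hwi]
    · simp [hy]
  by_cases hz : z ∈ B
  · rw [Set.indicator_of_mem hz]
    obtain ⟨h1, h2⟩ := linePoly_deg P hP y w
    have h3 := sub_one_dim d hd _ h1 (by rw [h2]; exact hT) δ hδ
    rw [h2] at h3
    refine (measure_mono ?_).trans h3
    intro t ht
    have ht' : (MeasurableEquiv.piFinSuccAbove (fun _ : Fin (m + 1) => ℝ) i).symm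
      (t, z + fun j => w (i.succAbove j) * t) ∈ S := ht
    rw [hsec] at ht'
    have := ht'.1
    simp only [Set.mem_ofPred_eq] at this ⊢
    rwa [linePoly_eval]
  · rw [Set.indicator_of_notMem hz]
    have : (fun x : ℝ => (x, z)) ⁻¹' ((fun p : ℝ × (Fin m → ℝ) =>
      (id p.1, p.2 + fun j => w (i.succAbove j) * p.1)) ⁻¹' S1) = ∅ := by
      refine Set.eq_empty_of_forall_notMem fun t ht => hz ?_
      have ht' : (MeasurableEquiv.piFinSuccAbove (fun _ : Fin (m + 1) => ℝ) i).symm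
        (t, z + fun j => w (i.succAbove j) * t) ∈ S := ht
      rw [hsec] at ht'
      have hcu := ht'.2
      simp only [Set.mem_ofPred_eq] at hcu
      have hti : |t| < r := by
        have := hcu i
        simp only [hy, Fin.insertNth_apply_same, hwi, zero_add, one_mul] at this
        exact abs_lt.mpr this
      intro j _
      have h1 := hcu (i.succAbove j)
      simp only [hy, Fin.insertNth_apply_succAbove] at h1
      have h2 : |w (i.succAbove j) * t| < r := by
        rw [abs_mul]
        have := mul_le_mul_of_nonneg_right (hw (i.succAbove j)) (abs_nonneg t)
        linarith
      rw [abs_lt] at h2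
      obtain ⟨h3, h4⟩ := h1
      exact ⟨by linarith [h2.2], by linarith [h2.1]⟩
    rw [this]; simp

/-- For polynomials `P` of degree `d ≥ 1` on `ℝ^n` and any multi-index `α` with
`|α| = d` and `a_α ≠ 0`, there is a constant `C'_{d,n} > 0` depending only on `d, n`
such that `vol (V_δ ∩ Δ_r^n) ≤ C'_{d,n} (α! |a_α|)^{-1/d} r^{n-1} δ^{1/d}` for all
`δ > 0`, `r > 0`. -/
theorem statement15 (n d : ℕ) (hd : 1 ≤ d) :
    ∃ C : ℝ, 0 < C ∧
      ∀ P : MvPolynomial (Fin n) ℝ, P.totalDegree = d →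
        ∀ α : Fin n →₀ ℕ, (∑ i, α i) = d → coeff α P ≠ 0 →
          ∀ δ : ℝ, 0 < δ → ∀ r : ℝ, 0 < r →
            volume (sublevel P δ ∩ cube n r) ≤
              ENNReal.ofReal
                (C / (((∏ i, Nat.factorial (α i) : ℕ) : ℝ) * |coeff α P|) ^ ((1 : ℝ) / d) *
                  r ^ (n - 1) * δ ^ ((1 : ℝ) / d)) := by
  have hd0 : (0 : ℝ) < d := by exact_mod_cast hd
  refine ⟨4 ^ (n - 1) * (2 * d) * (2 * d), by positivity, ?_⟩
  intro P hP α hα hc δ hδ r hr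
  obtain ⟨w, i, hwi, hw, hA⟩ := exists_dir hd P α hα hc
  obtain _ | m := n
  · exact i.elim0
  have hfac : (0 : ℝ) < ((∏ i, Nat.factorial (α i) : ℕ) : ℝ) := by
    exact_mod_cast Finset.prod_pos fun i _ => Nat.factorial_pos _
  set A : ℝ := ((∏ i, Nat.factorial (α i) : ℕ) : ℝ) * |coeff α P| with hAdef
  have hApos : 0 < A := mul_pos hfac (abs_pos.mpr hc)
  have hTpos : 0 < |topFun P d w| := by
    by_contra h
    have : |topFun P d w| = 0 := le_antisymm (not_lt.mp h) (abs_nonneg _)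
    rw [this, mul_zero] at hA
    linarith
  refine (slice_bound hd P hP w i hwi hw (abs_pos.mp hTpos) δ r hδ hr).trans ?_
  rw [← ENNReal.ofReal_mul (by positivity)]
  refine ENNReal.ofReal_le_ofReal ?_
  have h1 : (δ / |topFun P d w|) ^ ((1 : ℝ) / d) ≤
      (2 * d) * (δ ^ ((1 : ℝ) / d) / A ^ ((1 : ℝ) / d)) := by
    have h2 : δ / |topFun P d w| ≤ (2 * d) ^ d * (δ / A) := by
      rw [div_le_iff₀ hTpos]
      have : (2 * (d : ℝ)) ^ d * (δ / A) * |topFun P d w| =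
        δ * (((2 * (d : ℝ)) ^ d * |topFun P d w|) / A) := by ring
      rw [this]
      refine le_mul_of_one_le_right hδ.le ?_
      rwa [one_le_div hApos]
    refine (Real.rpow_le_rpow (by positivity) h2 (by positivity)).trans ?_
    rw [Real.mul_rpow (by positivity) (by positivity), Real.div_rpow hδ.le hApos.le, one_div,
      Real.pow_rpow_inv_natCast (by positivity) (by omega)]
  calc (d : ℝ) * (2 * (δ / |topFun P d w|) ^ ((1 : ℝ) / d)) * (4 * r) ^ m
      ≤ (d : ℝ) * (2 * ((2 * d) * (δ ^ ((1 : ℝ) / d) / A ^ ((1 : ℝ) / d)))) * (4 * r) ^ m := by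
        gcongr
    _ = _ := by
        rw [Nat.add_sub_cancel, mul_pow]
        ring
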